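/- Let w ∈ ℂ with w ∉ Λ and let u ∈ ℂ. Suppose f : ℂ ∖ (u + Λ) → ℂ is holomorphic, satisfies f(t+1) = f(t) and f(t+τ) = e^{2πi w}·f(t) for all t ∉ u + Λ, and the function t ↦ (t − u)·f(t) extends holomorphically to a neighborhood of u with value 1 at u. Then f(t) = σ_w(t − u, τ) for all t ∉ u + Λ. In particular, σ_w(t−u,τ) is the unique function holomorphic on ℂ ∖ (u+Λ) with this quasi-periodicity and a simple pole of residue 1 at u. -/

import Mathlib

open Complex Filter
open scoped Topology

noncomputable section

/-- The lattice `Λ = ℤτ + ℤ ⊂ ℂ` as a set. -/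
def Lam (τ : ℂ) : Set ℂ := {c | ∃ l m : ℤ, c = l * τ + m}

/-- The infinite product `(y;q) = ∏_{j=0}^∞ (1 - y qʲ)`. -/
def qPoch (y q : ℂ) : ℂ := ∏' j : ℕ, (1 - y * q ^ j)

/-- The first Jacobi theta function
`θ(z,τ) = i e^{πi(τ/4 - z)} (x;q)(q/x;q)(q;q)`, `q = e^{2πiτ}`, `x = e^{2πiz}`. -/
def theta (z τ : ℂ) : ℂ :=
  Complex.I * Complex.exp ((Real.pi : ℂ) * Complex.I * (τ / 4 - z)) *
    qPoch (Complex.exp (2 * (Real.pi : ℂ) * Complex.I * z))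
      (Complex.exp (2 * (Real.pi : ℂ) * Complex.I * τ)) *
    qPoch (Complex.exp (2 * (Real.pi : ℂ) * Complex.I * τ) /
        Complex.exp (2 * (Real.pi : ℂ) * Complex.I * z))
      (Complex.exp (2 * (Real.pi : ℂ) * Complex.I * τ)) *
    qPoch (Complex.exp (2 * (Real.pi : ℂ) * Complex.I * τ))
      (Complex.exp (2 * (Real.pi : ℂ) * Complex.I * τ))

/-- `θ'(z,τ)`, the derivative of `θ` in the `z` variable. -/
def thetaD (z τ : ℂ) : ℂ := deriv (fun u => theta u τ) z

/-- `σ_w(t,τ) = θ(w-t,τ)θ'(0,τ)/(θ(w,τ)θ(t,τ))`. -/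
def sigmaW (w t τ : ℂ) : ℂ := theta (w - t) τ * thetaD 0 τ / (theta w τ * theta t τ)

lemma norm_nome_lt_one {τ : ℂ} (hτ : 0 < τ.im) :
    ‖Complex.exp (2 * (Real.pi : ℂ) * Complex.I * τ)‖ < 1 :=
  UpperHalfPlane.norm_exp_two_pi_I_lt_one ⟨τ, hτ⟩

lemma summable_norm_neg_mul_pow (y : ℂ) {q : ℂ} (hq : ‖q‖ < 1) :
    Summable fun j : ℕ => ‖-(y * q ^ j)‖ := by
  simpa using (summable_geometric_of_lt_one (norm_nonneg _) hq).mul_left ‖y‖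

lemma multipliable_one_sub_mul_pow (y : ℂ) {q : ℂ} (hq : ‖q‖ < 1) :
    Multipliable fun j : ℕ => 1 - y * q ^ j := by
  simpa [sub_eq_add_neg] using multipliable_one_add_of_summable (summable_norm_neg_mul_pow y hq)

lemma qPoch_eq_mul (y : ℂ) {q : ℂ} (hq : ‖q‖ < 1) :
    qPoch y q = (1 - y) * qPoch (y * q) q := by
  have h : (fun j : ℕ => 1 - y * q ^ (j + 1)) = fun j : ℕ => 1 - y * q * q ^ j := by
    ext j; ring
  rw [qPoch, tprod_eq_zero_mul' (h ▸ multipliable_one_sub_mul_pow (y * q) hq), h]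
  simp [qPoch]

lemma qPoch_eq_zero_iff (y : ℂ) {q : ℂ} (hq : ‖q‖ < 1) :
    qPoch y q = 0 ↔ ∃ j : ℕ, y * q ^ j = 1 := by
  constructor
  · contrapose!
    intro h
    have := tprod_one_add_ne_zero_of_summable (f := fun j : ℕ => -(y * q ^ j))
      (fun j => by simpa [← sub_eq_add_neg, sub_eq_zero] using (h j).symm)
      (summable_norm_neg_mul_pow y hq)
    simpa [qPoch, sub_eq_add_neg] using this
  · rintro ⟨j, hj⟩
    exact tprod_of_exists_eq_zero ⟨j, by simp [hj]⟩

lemma qPoch_self_ne_zero {q : ℂ} (hq : ‖q‖ < 1) : qPoch q q ≠ 0 := by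
  rw [Ne, qPoch_eq_zero_iff _ hq]
  rintro ⟨j, hj⟩
  rw [← pow_succ'] at hj
  have := pow_lt_one₀ (norm_nonneg _) hq j.succ_ne_zero
  rw [← norm_pow, hj, norm_one] at this
  exact this.false

lemma differentiable_qPoch {q : ℂ} (hq : ‖q‖ < 1) : Differentiable ℂ fun y => qPoch y q := by
  intro y
  have h : HasProdLocallyUniformlyOn (fun (j : ℕ) (y : ℂ) => 1 + -(y * q ^ j))
      (fun y => ∏' j : ℕ, (1 + -(y * q ^ j))) (Metric.ball (0 : ℂ) (‖y‖ + 1)) :=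
    Summable.hasProdLocallyUniformlyOn_nat_one_add Metric.isOpen_ball
      ((summable_geometric_of_lt_one (norm_nonneg _) hq).mul_left (‖y‖ + 1))
      (.of_forall fun j z hz => by
        rw [norm_neg, norm_mul, norm_pow]
        have := (mem_ball_zero_iff.mp hz).le
        gcongr)
      (fun j => by fun_prop)
  have hd := h.differentiableOn
    (.of_forall fun _ => by simpa [Finset.prod_fn] using
      DifferentiableOn.finsetProd (fun _ _ => by fun_prop)) Metric.isOpen_ball
  simpa [qPoch, sub_eq_add_neg] using
    hd.differentiableAt (Metric.isOpen_ball.mem_nhds (by simp : y ∈ Metric.ball (0 : ℂ) (‖y‖ + 1)))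

lemma differentiable_theta {τ : ℂ} (hτ : 0 < τ.im) : Differentiable ℂ fun z => theta z τ := by
  have hQ := differentiable_qPoch (norm_nome_lt_one hτ)
  have h₁ : Differentiable ℂ fun z : ℂ => Complex.exp (2 * (Real.pi : ℂ) * Complex.I * z) := by
    fun_prop
  have h₂ : Differentiable ℂ fun z : ℂ => Complex.exp (2 * (Real.pi : ℂ) * Complex.I * τ) /
      Complex.exp (2 * (Real.pi : ℂ) * Complex.I * z) :=
    (differentiable_const _).div h₁ fun z => Complex.exp_ne_zero _
  exact (((by fun_prop : Differentiable ℂ fun z : ℂ => Complex.I *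
    Complex.exp ((Real.pi : ℂ) * Complex.I * (τ / 4 - z))).mul (hQ.comp h₁)).mul
      (hQ.comp h₂)).mul_const _

lemma exp_two_pi_I_mul_eq_one_iff (z : ℂ) :
    Complex.exp (2 * (Real.pi : ℂ) * Complex.I * z) = 1 ↔ ∃ n : ℤ, z = n := by
  rw [Complex.exp_eq_one_iff]
  refine exists_congr fun n => ?_
  rw [mul_comm, mul_left_inj' Complex.two_pi_I_ne_zero]

lemma exp_two_pi_I_mul_pow (z τ : ℂ) (j : ℕ) :
    Complex.exp (2 * (Real.pi : ℂ) * Complex.I * z) *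
      Complex.exp (2 * (Real.pi : ℂ) * Complex.I * τ) ^ j =
    Complex.exp (2 * (Real.pi : ℂ) * Complex.I * (z + j * τ)) := by
  rw [← Complex.exp_nat_mul, ← Complex.exp_add]
  congr 1
  ring

lemma theta_eq_zero_iff {τ : ℂ} (hτ : 0 < τ.im) (z : ℂ) : theta z τ = 0 ↔ z ∈ Lam τ := by
  have hq := norm_nome_lt_one hτ
  have hdiv : Complex.exp (2 * (Real.pi : ℂ) * Complex.I * τ) /
      Complex.exp (2 * (Real.pi : ℂ) * Complex.I * z) =
      Complex.exp (2 * (Real.pi : ℂ) * Complex.I * (τ - z)) := by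
    rw [← Complex.exp_sub]; congr 1; ring
  have hqq := qPoch_self_ne_zero hq
  simp only [theta, mul_eq_zero, Complex.exp_ne_zero, Complex.I_ne_zero, hqq, or_false, false_or,
    hdiv, qPoch_eq_zero_iff _ hq, exp_two_pi_I_mul_pow, exp_two_pi_I_mul_eq_one_iff]
  constructor
  · rintro (⟨j, n, h⟩ | ⟨j, n, h⟩)
    · exact ⟨-j, n, by push_cast; linear_combination h⟩
    · exact ⟨j + 1, -n, by push_cast; linear_combination -h⟩
  · rintro ⟨l, m, rfl⟩
    rcases le_or_gt l 0 with hl | hl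
    · obtain ⟨j, hj⟩ := Int.eq_ofNat_of_zero_le (neg_nonneg.mpr hl)
      obtain rfl : l = -j := by omega
      exact .inl ⟨j, m, by push_cast; ring⟩
    · obtain ⟨j, hj⟩ := Int.eq_ofNat_of_zero_le (by omega : 0 ≤ l - 1)
      obtain rfl : l = j + 1 := by omega
      exact .inr ⟨j, -m, by push_cast; ring⟩

lemma theta_add_one (z τ : ℂ) : theta (z + 1) τ = -theta z τ := by
  have h₁ : Complex.exp (2 * (Real.pi : ℂ) * Complex.I * (z + 1)) =
      Complex.exp (2 * (Real.pi : ℂ) * Complex.I * z) := by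
    rw [mul_add, mul_one, Complex.exp_add, Complex.exp_two_pi_mul_I, mul_one]
  have h₂ : Complex.exp ((Real.pi : ℂ) * Complex.I * (τ / 4 - (z + 1))) =
      -Complex.exp ((Real.pi : ℂ) * Complex.I * (τ / 4 - z)) := by
    rw [← sub_sub, mul_sub _ _ (1 : ℂ), mul_one, Complex.exp_sub, Complex.exp_pi_mul_I, div_neg,
      div_one]
  simp only [theta, h₁, h₂]
  ring

lemma theta_add_tau {τ : ℂ} (hτ : 0 < τ.im) (z : ℂ) :
    theta (z + τ) τ =
      -Complex.exp (-(Real.pi : ℂ) * Complex.I * (τ + 2 * z)) * theta z τ := by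
  have hq := norm_nome_lt_one hτ
  have h₁ : Complex.exp (2 * (Real.pi : ℂ) * Complex.I * (z + τ)) =
      Complex.exp (2 * (Real.pi : ℂ) * Complex.I * z) *
        Complex.exp (2 * (Real.pi : ℂ) * Complex.I * τ) := by
    rw [mul_add, Complex.exp_add]
  have h₂ : Complex.exp ((Real.pi : ℂ) * Complex.I * (τ / 4 - (z + τ))) =
      Complex.exp ((Real.pi : ℂ) * Complex.I * (τ / 4 - z)) *
        Complex.exp (-(Real.pi : ℂ) * Complex.I * τ) := by
    rw [← Complex.exp_add]; congr 1; ring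
  have h₃ : Complex.exp (-(Real.pi : ℂ) * Complex.I * (τ + 2 * z)) =
      Complex.exp (-(Real.pi : ℂ) * Complex.I * τ) *
        (Complex.exp (2 * (Real.pi : ℂ) * Complex.I * z))⁻¹ := by
    rw [← Complex.exp_neg, ← Complex.exp_add]; congr 1; ring
  simp only [theta, h₁, h₂, h₃]
  have hx := Complex.exp_ne_zero (2 * (Real.pi : ℂ) * Complex.I * z)
  have hq0 := Complex.exp_ne_zero (2 * (Real.pi : ℂ) * Complex.I * τ)
  generalize Complex.exp (2 * (Real.pi : ℂ) * Complex.I * z) = x at *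
  generalize Complex.exp (2 * (Real.pi : ℂ) * Complex.I * τ) = q at *
  have h₄ : q / (x * q) = x⁻¹ := by field_simp
  have h₅ : x⁻¹ * q = q / x := by field_simp
  rw [h₄, qPoch_eq_mul x hq, qPoch_eq_mul x⁻¹ hq, h₅]
  field_simp
  ring

lemma theta_zero {τ : ℂ} (hτ : 0 < τ.im) : theta 0 τ = 0 :=
  (theta_eq_zero_iff hτ 0).mpr ⟨0, 0, by simp⟩

lemma thetaD_zero_ne_zero {τ : ℂ} (hτ : 0 < τ.im) : thetaD 0 τ ≠ 0 := by
  have hq := norm_nome_lt_one hτ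
  have hQ := differentiable_qPoch hq
  set q := Complex.exp (2 * (Real.pi : ℂ) * Complex.I * τ) with hqdef
  have hqq := qPoch_self_ne_zero hq
  have h₁ : Differentiable ℂ fun z : ℂ => Complex.exp (2 * (Real.pi : ℂ) * Complex.I * z) := by
    fun_prop
  have h₂ : Differentiable ℂ fun z : ℂ => q / Complex.exp (2 * (Real.pi : ℂ) * Complex.I * z) :=
    (differentiable_const _).div h₁ fun z => Complex.exp_ne_zero _
  set H : ℂ → ℂ := fun z => Complex.I * Complex.exp ((Real.pi : ℂ) * Complex.I * (τ / 4 - z)) *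
    qPoch (Complex.exp (2 * (Real.pi : ℂ) * Complex.I * z) * q) q *
    qPoch (q / Complex.exp (2 * (Real.pi : ℂ) * Complex.I * z)) q * qPoch q q with hH
  have hHd : Differentiable ℂ H :=
    (((by fun_prop : Differentiable ℂ fun z : ℂ => Complex.I *
      Complex.exp ((Real.pi : ℂ) * Complex.I * (τ / 4 - z))).mul
        (hQ.comp (h₁.mul_const q))).mul (hQ.comp h₂)).mul_const _
  have hfac : (fun z => theta z τ) =
      fun z => (1 - Complex.exp (2 * (Real.pi : ℂ) * Complex.I * z)) * H z := by
    ext z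
    simp only [theta, hH, ← hqdef]
    rw [qPoch_eq_mul (Complex.exp (2 * (Real.pi : ℂ) * Complex.I * z)) hq]
    ring
  have hlin : HasDerivAt (fun z : ℂ => 1 - Complex.exp (2 * (Real.pi : ℂ) * Complex.I * z))
      (-(2 * (Real.pi : ℂ) * Complex.I)) 0 := by
    simpa using (((hasDerivAt_id (0 : ℂ)).const_mul
      (2 * (Real.pi : ℂ) * Complex.I)).cexp).const_sub 1
  have hder := hlin.mul (hHd 0).hasDerivAt
  have hval : thetaD 0 τ = -(2 * (Real.pi : ℂ) * Complex.I) * H 0 := by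
    rw [thetaD, hfac]
    refine hder.deriv.trans ?_
    simp
  rw [hval]
  simp [hH, hqq, Real.pi_ne_zero]

lemma eventually_notMem_Lam {τ : ℂ} (hτ : 0 < τ.im) {w : ℂ} (hw : w ∉ Lam τ) (t : ℂ) :
    ∀ᶠ s in 𝓝[≠] t, s ∉ Lam τ := by
  have hA : AnalyticOnNhd ℂ (fun z => theta z τ) Set.univ := fun z _ =>
    (differentiable_theta hτ).analyticAt z
  simp only [← theta_eq_zero_iff hτ] at hw ⊢
  by_contra h
  exact hw (hA.eqOn_zero_of_preconnected_of_frequently_eq_zero isPreconnected_univ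
    (Set.mem_univ t) h (Set.mem_univ w))

lemma isClosed_Lam {τ : ℂ} (hτ : 0 < τ.im) : IsClosed (Lam τ) := by
  have : Lam τ = (fun z => theta z τ) ⁻¹' {0} := by
    ext z; simp [theta_eq_zero_iff hτ]
  rw [this]
  exact isClosed_singleton.preimage (differentiable_theta hτ).continuous

/-- `f` agrees on a punctured neighbourhood of `t` with a function analytic at `t`. -/
def HasAnalyticExtensionAt (f : ℂ → ℂ) (t : ℂ) : Prop :=
  ∃ g : ℂ → ℂ, AnalyticAt ℂ g t ∧ f =ᶠ[𝓝[≠] t] g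

lemma exists_differentiable_eventuallyEq {f : ℂ → ℂ} (hf : ∀ t, HasAnalyticExtensionAt f t) :
    ∃ F : ℂ → ℂ, Differentiable ℂ F ∧ ∀ t, f =ᶠ[𝓝[≠] t] F := by
  choose g hg hfg using hf
  have hlim : ∀ t a, (∃ h : ℂ → ℂ, AnalyticAt ℂ h t ∧ f =ᶠ[𝓝[≠] t] h ∧ h t = a) →
      limUnder (𝓝[≠] t) f = a := by
    rintro t a ⟨h, hh, hfh, rfl⟩
    exact ((hh.continuousAt.tendsto.mono_left nhdsWithin_le_nhds).congr' hfh.symm).limUnder_eq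
  have key : ∀ t, (fun s => limUnder (𝓝[≠] s) f) =ᶠ[𝓝 t] g t := by
    intro t
    have h₁ : ∀ᶠ s in 𝓝[≠] t, f =ᶠ[𝓝 s] g t := by
      have := eventually_eventually_nhdsWithin.mpr (hfg t)
      filter_upwards [this, self_mem_nhdsWithin] with s hs hst
      rwa [IsOpen.nhdsWithin_eq isOpen_compl_singleton hst] at hs
    have h₂ : ∀ᶠ s in 𝓝 t, s ≠ t → f =ᶠ[𝓝 s] g t := eventually_nhdsWithin_iff.mp h₁
    filter_upwards [h₂, (hg t).eventually_analyticAt] with s hs hga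
    by_cases hst : s = t
    · subst hst
      exact hlim s _ ⟨g s, hg s, hfg s, rfl⟩
    · exact hlim s _ ⟨g t, hga, (hs hst).filter_mono nhdsWithin_le_nhds, rfl⟩
  refine ⟨fun s => limUnder (𝓝[≠] s) f, fun t => ?_, fun t => ?_⟩
  · exact ((hg t).differentiableAt).congr_of_eventuallyEq (key t)
  · exact (hfg t).trans ((key t).filter_mono nhdsWithin_le_nhds).symm

lemma tendsto_add_const_nhdsNE (t c : ℂ) : Tendsto (· + c) (𝓝[≠] t) (𝓝[≠] (t + c)) :=
  tendsto_nhdsWithin_iff.mpr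
    ⟨((continuous_add_const c).tendsto t).mono_left nhdsWithin_le_nhds,
      eventually_mem_nhdsWithin.mono fun _ hs => by simpa using hs⟩

lemma hasAnalyticExtensionAt_add_iff {f : ℂ → ℂ} {b c : ℂ} (hb : b ≠ 0)
    (h : ∀ t, ∀ᶠ s in 𝓝[≠] t, f (s + c) = b * f s) (t : ℂ) :
    HasAnalyticExtensionAt f (t + c) ↔ HasAnalyticExtensionAt f t := by
  constructor
  · rintro ⟨g, hg, hfg⟩
    refine ⟨fun s => b⁻¹ * g (s + c),
      analyticAt_const.mul (hg.comp_of_eq (analyticAt_id.add analyticAt_const) rfl), ?_⟩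
    filter_upwards [h t, (tendsto_add_const_nhdsNE t c).eventually hfg] with s h₁ h₂
    rw [← h₂, h₁, inv_mul_cancel_left₀ hb]
  · rintro ⟨g, hg, hfg⟩
    refine ⟨fun s => b * g (s - c), analyticAt_const.mul
      (hg.comp_of_eq (analyticAt_id.sub analyticAt_const) (by simp)), ?_⟩
    have hT := tendsto_add_const_nhdsNE (t + c) (-c)
    rw [add_neg_cancel_right] at hT
    filter_upwards [hT.eventually (h t), hT.eventually hfg] with s h₁ h₂
    rw [neg_add_cancel_right] at h₁
    rw [h₁, h₂, sub_eq_add_neg]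

lemma eq_of_eventuallyEq_nhdsNE {F G : ℂ → ℂ} (hF : Continuous F) (hG : Continuous G) {t : ℂ}
    (h : F =ᶠ[𝓝[≠] t] G) : F t = G t :=
  tendsto_nhds_unique ((hF.tendsto t).mono_left nhdsWithin_le_nhds)
    (((hG.tendsto t).mono_left nhdsWithin_le_nhds).congr' h.symm)

/-- A continuous function on `ℂ` with periods `1` and `τ`, `Im τ > 0`, is bounded. -/
lemma exists_forall_le_of_periodic {τ : ℂ} (hτ : 0 < τ.im) {N : ℂ → ℝ} (hN : Continuous N)
    (h₁ : Function.Periodic N 1) (h₂ : Function.Periodic N τ) : ∃ C, ∀ t, N t ≤ C := by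
  have hK : IsCompact ((fun p : ℝ × ℝ => (p.1 : ℂ) * τ + p.2) ''
      (Set.Icc (0 : ℝ) 1 ×ˢ Set.Icc (0 : ℝ) 1)) :=
    (isCompact_Icc.prod isCompact_Icc).image (by fun_prop)
  obtain ⟨C, hC⟩ := (hK.image hN).bddAbove
  refine ⟨C, fun t => ?_⟩
  set a : ℝ := t.im / τ.im with ha
  set b : ℝ := t.re - a * τ.re with hb
  have ht : t = a * τ + b := by
    apply Complex.ext
    · simp [hb]
    · simp [ha, hτ.ne']
  have hmem : N (Int.fract a * τ + Int.fract b) ≤ C :=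
    hC ⟨_, ⟨(Int.fract a, Int.fract b), ⟨⟨Int.fract_nonneg _, (Int.fract_lt_one _).le⟩,
      ⟨Int.fract_nonneg _, (Int.fract_lt_one _).le⟩⟩, rfl⟩, rfl⟩
  have hdec : t = ((Int.fract a : ℝ) * τ + (Int.fract b : ℝ) : ℂ) + ⌊a⌋ * τ + ⌊b⌋ * 1 := by
    rw [ht]
    simp only [Int.fract]
    push_cast
    ring
  rw [hdec, h₁.int_mul, h₂.int_mul]
  exact hmem

/-- The line bundle on `ℂ / Λ` with multipliers `1` and `e^{2πiw}` has no nonzero sections when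
`w ∉ Λ`. -/
lemma eq_zero_of_quasiPeriodic {τ : ℂ} (hτ : 0 < τ.im) {w : ℂ} (hw : w ∉ Lam τ) {F : ℂ → ℂ}
    (hF : Differentiable ℂ F) (h₁ : ∀ t, F (t + 1) = F t)
    (h₂ : ∀ t, F (t + τ) = Complex.exp (2 * (Real.pi : ℂ) * Complex.I * w) * F t) (t : ℂ) :
    F t = 0 := by
  set γ : ℝ := w.im / τ.im with hγ
  have hγτ : γ * τ.im = w.im := by rw [hγ]; field_simp
  set E : ℂ → ℂ := fun t => Complex.exp (-(2 * (Real.pi : ℂ) * Complex.I * (γ * t))) * F t with hE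
  have hEd : Differentiable ℂ E := by fun_prop
  have hE1 : ∀ t, E (t + 1) = Complex.exp (-(2 * (Real.pi : ℂ) * Complex.I * γ)) * E t := by
    intro t
    simp only [hE, h₁, ← mul_assoc, ← Complex.exp_add]
    congr 2
    ring
  have hEτ : ∀ t, E (t + τ) =
      Complex.exp (2 * (Real.pi : ℂ) * Complex.I * (w - γ * τ)) * E t := by
    intro t
    simp only [hE, h₂, ← mul_assoc, ← Complex.exp_add]
    congr 2
    ring
  obtain ⟨C, hC⟩ := exists_forall_le_of_periodic hτ hEd.continuous.norm
    (fun t => by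
      simp only [hE1, norm_mul, Complex.norm_exp]
      simp)
    (fun t => by
      simp only [hEτ, norm_mul, Complex.norm_exp]
      simp [hγτ])
  have hconst : ∀ z z', E z = E z' := hEd.apply_eq_apply_of_bounded
    (isBounded_iff_forall_norm_le.mpr ⟨C, by rintro _ ⟨t, rfl⟩; exact hC t⟩)
  by_contra hne
  have hEt : E t ≠ 0 := mul_ne_zero (Complex.exp_ne_zero _) hne
  have e₁ : Complex.exp (-(2 * (Real.pi : ℂ) * Complex.I * γ)) = 1 :=
    mul_right_cancel₀ hEt (by rw [← hE1, one_mul]; exact hconst _ _)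
  have e₂ : Complex.exp (2 * (Real.pi : ℂ) * Complex.I * (w - γ * τ)) = 1 :=
    mul_right_cancel₀ hEt (by rw [← hEτ, one_mul]; exact hconst _ _)
  rw [← mul_neg, exp_two_pi_I_mul_eq_one_iff] at e₁
  rw [exp_two_pi_I_mul_eq_one_iff] at e₂
  obtain ⟨l, hl⟩ := e₁
  obtain ⟨m, hm⟩ := e₂
  exact hw ⟨-l, m, by push_cast; linear_combination hm - τ * hl⟩

lemma sigmaW_add_one (w t τ : ℂ) : sigmaW w (t + 1) τ = sigmaW w t τ := by
  have h : theta (w - (t + 1)) τ = -theta (w - t) τ := by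
    have := theta_add_one (w - (t + 1)) τ
    rw [← sub_sub, sub_add_cancel] at this
    rw [this, neg_neg, sub_sub]
  rw [sigmaW, sigmaW, h, theta_add_one, neg_mul, mul_neg, neg_div_neg_eq]

lemma sigmaW_add_tau {τ : ℂ} (hτ : 0 < τ.im) (w t : ℂ) :
    sigmaW w (t + τ) τ =
      Complex.exp (2 * (Real.pi : ℂ) * Complex.I * w) * sigmaW w t τ := by
  have h := theta_add_tau hτ (w - (t + τ))
  rw [← sub_sub, sub_add_cancel, sub_sub] at h
  have hexp : Complex.exp (2 * (Real.pi : ℂ) * Complex.I * w) *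
      Complex.exp (-(Real.pi : ℂ) * Complex.I * (τ + 2 * (w - (t + τ)))) *
      Complex.exp (-(Real.pi : ℂ) * Complex.I * (τ + 2 * t)) = 1 := by
    rw [← Complex.exp_add, ← Complex.exp_add, ← Complex.exp_zero]
    congr 1
    ring
  rw [sigmaW, sigmaW, theta_add_tau hτ t, h]
  have e₁ := Complex.exp_ne_zero (-(Real.pi : ℂ) * Complex.I * (τ + 2 * t))
  generalize Complex.exp (-(Real.pi : ℂ) * Complex.I * (τ + 2 * t)) = B at *
  generalize Complex.exp (-(Real.pi : ℂ) * Complex.I * (τ + 2 * (w - (t + τ)))) = A at *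
  generalize Complex.exp (2 * (Real.pi : ℂ) * Complex.I * w) = c at *
  by_cases hz : theta w τ * theta t τ = 0
  · rcases mul_eq_zero.mp hz with hz | hz <;> simp [hz]
  rw [← mul_div_assoc, div_eq_div_iff (by simpa [e₁] using hz) hz]
  linear_combination (theta (w - (t + τ)) τ * thetaD 0 τ * theta w τ * theta t τ) * (-hexp)

/-- Near its pole at `0`, `t * σ_w(t, τ)` extends analytically with value `1`. -/
lemma exists_analyticAt_mul_sigmaW {τ : ℂ} (hτ : 0 < τ.im) {w : ℂ} (hw : w ∉ Lam τ) :
    ∃ k : ℂ → ℂ, AnalyticAt ℂ k 0 ∧ k 0 = 1 ∧ ∀ᶠ t in 𝓝[≠] (0 : ℂ), k t = t * sigmaW w t τ := by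
  have hθ := differentiable_theta hτ
  have hw' : theta w τ ≠ 0 := mt (theta_eq_zero_iff hτ w).mp hw
  have hD := thetaD_zero_ne_zero hτ
  set r : ℂ → ℂ := dslope (fun z => theta z τ) 0 with hr
  have hr0 : r 0 = thetaD 0 τ := dslope_same _ _
  have hra : AnalyticAt ℂ r 0 :=
    ((Complex.differentiableOn_dslope univ_mem).mpr hθ.differentiableOn).analyticAt univ_mem
  refine ⟨fun t => theta (w - t) τ * thetaD 0 τ / (theta w τ * r t), ?_, ?_, ?_⟩
  · have h : AnalyticAt ℂ (fun t => theta (w - t) τ) 0 :=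
      (hθ.comp (differentiable_id.const_sub w)).analyticAt 0
    exact (h.mul analyticAt_const).div (analyticAt_const.mul hra)
      (mul_ne_zero hw' (hr0 ▸ hD))
  · simp only [hr0, sub_zero]
    exact div_self (mul_ne_zero hw' hD)
  · filter_upwards [self_mem_nhdsWithin] with t ht
    have ht : t ≠ 0 := ht
    have : theta t τ = t * r t := by
      have := sub_smul_dslope (fun z => theta z τ) 0 t
      simpa [theta_zero hτ] using this.symm
    rw [sigmaW, this]
    field_simp

/-- `σ_w(t-u,τ)` is the unique function holomorphic on `ℂ ∖ (u+Λ)` with quasi-periods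
`f(t+1) = f(t)`, `f(t+τ) = e^{2πiw} f(t)` and a simple pole of residue `1` at `u`. -/
theorem sigma_uniqueness (τ : ℂ) (hτ : 0 < τ.im) (w : ℂ) (hw : w ∉ Lam τ) (u : ℂ)
    (f : ℂ → ℂ)
    (hf : DifferentiableOn ℂ f {t : ℂ | t - u ∉ Lam τ})
    (hper1 : ∀ t : ℂ, t - u ∉ Lam τ → f (t + 1) = f t)
    (hperτ : ∀ t : ℂ, t - u ∉ Lam τ →
      f (t + τ) = Complex.exp (2 * (Real.pi : ℂ) * Complex.I * w) * f t)
    (hres : ∃ g : ℂ → ℂ, ∃ s : Set ℂ, s ∈ nhds u ∧ DifferentiableOn ℂ g s ∧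
      g u = 1 ∧ ∀ t ∈ s, t ≠ u → g t = (t - u) * f t) :
    ∀ t : ℂ, t - u ∉ Lam τ → f t = sigmaW w (t - u) τ := by
  have hθ := differentiable_theta hτ
  have hev := eventually_notMem_Lam hτ hw
  set d : ℂ → ℂ := fun t => f (t + u) - sigmaW w t τ with hd
  have hd1 : ∀ t, t ∉ Lam τ → d (t + 1) = 1 * d t := by
    intro t ht
    simp only [hd]
    rw [sigmaW_add_one, add_right_comm, hper1 _ (by simpa using ht), one_mul]
  have hdτ : ∀ t, t ∉ Lam τ →
      d (t + τ) = Complex.exp (2 * (Real.pi : ℂ) * Complex.I * w) * d t := by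
    intro t ht
    simp only [hd]
    rw [sigmaW_add_tau hτ, add_right_comm, hperτ _ (by simpa using ht), mul_sub]
  have hda : ∀ t, t ∉ Lam τ → AnalyticAt ℂ d t := by
    intro t ht
    have hU : {t : ℂ | t - u ∉ Lam τ} ∈ 𝓝 (t + u) :=
      ((isClosed_Lam hτ).isOpen_compl.preimage
        (by fun_prop : Continuous fun t : ℂ => t - u)).mem_nhds (by simpa using ht)
    have hf' : AnalyticAt ℂ (fun t => f (t + u)) t :=
      (hf.analyticAt hU).comp_of_eq (analyticAt_id.add analyticAt_const) rfl
    have hθ' : AnalyticAt ℂ (fun t => theta (w - t) τ) t :=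
      (hθ.comp (differentiable_id.const_sub w)).analyticAt t
    refine hf'.sub ((hθ'.mul analyticAt_const).div (analyticAt_const.mul (hθ.analyticAt t)) ?_)
    exact mul_ne_zero (mt (theta_eq_zero_iff hτ w).mp hw) (mt (theta_eq_zero_iff hτ t).mp ht)
  have hd0 : HasAnalyticExtensionAt d 0 := by
    obtain ⟨g, s, hs, hg, hgu, hgf⟩ := hres
    obtain ⟨k, hk, hk0, hkσ⟩ := exists_analyticAt_mul_sigmaW hτ hw
    set m : ℂ → ℂ := fun t => g (t + u) - k t with hm
    have hma : AnalyticAt ℂ m 0 :=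
      ((hg.analyticAt hs).comp_of_eq (analyticAt_id.add analyticAt_const) (by simp)).sub hk
    have hT : Tendsto (fun t : ℂ => t + u) (𝓝 0) (𝓝 u) := by
      simpa using (continuous_add_const u).tendsto (0 : ℂ)
    obtain ⟨V, hV, hmV⟩ := hma.exists_mem_nhds_analyticOnNhd
    refine ⟨dslope m 0,
      ((Complex.differentiableOn_dslope hV).mpr hmV.differentiableOn).analyticAt hV, ?_⟩
    filter_upwards [hkσ, self_mem_nhdsWithin, (hT.mono_left nhdsWithin_le_nhds).eventually hs]
      with t h₁ h₂ h₃
    have h₂ : t ≠ 0 := h₂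
    have hmt : m t = t * d t := by
      simp only [hm, hd]
      rw [h₁, hgf _ h₃ (by simpa using h₂)]
      ring
    have hm0 : m 0 = 0 := by simp [hm, hgu, hk0]
    rw [dslope_of_ne _ h₂, slope_def_field, hm0, hmt]
    field_simp
    simp
  have hext : ∀ t, HasAnalyticExtensionAt d t := by
    intro t
    by_cases ht : t ∈ Lam τ
    · obtain ⟨l, m, rfl⟩ := ht
      have P₁ : Function.Periodic (HasAnalyticExtensionAt d) 1 := fun t =>
        propext (hasAnalyticExtensionAt_add_iff one_ne_zero (fun t => (hev t).mono hd1) t)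
      have P₂ : Function.Periodic (HasAnalyticExtensionAt d) τ := fun t =>
        propext (hasAnalyticExtensionAt_add_iff (Complex.exp_ne_zero _)
          (fun t => (hev t).mono hdτ) t)
      rw [← mul_one (m : ℂ), P₁.int_mul, ← zero_add (l * τ), P₂.int_mul]
      exact hd0
    · exact ⟨d, hda t ht, EventuallyEq.rfl⟩
  obtain ⟨F, hF, hdF⟩ := exists_differentiable_eventuallyEq hext
  have hFper : ∀ b c : ℂ, (∀ t, t ∉ Lam τ → d (t + c) = b * d t) → ∀ t, F (t + c) = b * F t := by
    intro b c h t
    refine eq_of_eventuallyEq_nhdsNE (F := fun t => F (t + c)) (G := fun t => b * F t)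
      (hF.continuous.comp (by fun_prop)) (hF.continuous.const_mul b) ?_
    filter_upwards [hev t, hdF t, (tendsto_add_const_nhdsNE t c).eventually (hdF (t + c))]
      with s h₁ h₂ h₃
    rw [← h₃, ← h₂, h s h₁]
  have hF0 := eq_zero_of_quasiPeriodic hτ hw hF (by simpa using hFper 1 1 hd1) (hFper _ τ hdτ)
  intro t ht
  have hdt : d (t - u) = 0 :=
    tendsto_nhds_unique ((hda _ ht).continuousAt.tendsto.mono_left nhdsWithin_le_nhds)
      (tendsto_const_nhds.congr' ((hdF (t - u)).mono fun s hs => by rw [hs, hF0]))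
  simpa [hd, sub_eq_zero] using hdt
end
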